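/- arXiv:2603.00765 — 2 statements merged into one kernel-verified Lean document; each statement's English description precedes it below -/
import Mathlib

section
/- Let n ≥ 3, p > n/2, and γ ∈ (0,2). There exists a constant C = C(n,p,γ) > 0 such that: for every Lebesgue-measurable set E contained in the open unit ball B₁ ⊂ ℝ^n, every measurable f : ℝ^n → ℝ with ‖f‖_{L^{p,∞}(E)} < ∞, and every continuously differentiable u : ℝ^n → ℝ with compact support, one has ∫_E |f| · |u|^γ dx ≤ C · ‖f‖_{L^{p,∞}(E)} · ( ‖u‖_{L²(ℝ^n)} + ‖∇u‖_{L²(ℝ^n)} )^γ · |E|^{(2-γ)/2 + γ/n - 1/p}. -/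
open MeasureTheory Metric Set

/-- A weak `L^p` function on a finite measure space lies in `L^q` for `q < p`, quantitatively. -/
lemma lintegral_enorm_rpow_le_of_weak_bound {α : Type*} [MeasurableSpace α] {μ : Measure α}
    [IsFiniteMeasure μ] {f : α → ℝ} (hf : Measurable f) {p q M : ℝ} (hq : 0 < q) (hqp : q < p)
    (hM : 0 ≤ M) (h : ∀ t : ℝ, 0 < t → t * μ.real {x | t < |f x|} ^ (1 / p) ≤ M) :
    ∫⁻ x, ‖f x‖ₑ ^ q ∂μ ≤
      ENNReal.ofReal (p / (p - q) * M ^ q * μ.real univ ^ (1 - q / p)) := by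
  have hp : 0 < p := hq.trans hqp
  rcases eq_or_ne μ 0 with rfl | hμ
  · simp
  have hlayer : ∫⁻ x, ‖f x‖ₑ ^ q ∂μ =
      ENNReal.ofReal q * ∫⁻ t in Ioi (0 : ℝ), μ {x | t < |f x|} * ENNReal.ofReal (t ^ (q - 1)) := by
    rw [← lintegral_rpow_eq_lintegral_meas_lt_mul μ (f := fun x => |f x|)
      (Filter.Eventually.of_forall fun x => abs_nonneg _) (by fun_prop) hq]
    refine lintegral_congr fun x => ?_
    rw [← ENNReal.ofReal_rpow_of_nonneg (abs_nonneg _) hq.le, Real.enorm_eq_ofReal_abs]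
  have htail : ∀ t : ℝ, 0 < t → μ {x | t < |f x|} ≤ ENNReal.ofReal ((M / t) ^ p) := by
    intro t ht
    rw [← ofReal_measureReal]
    refine ENNReal.ofReal_le_ofReal ?_
    have h1 : μ.real {x | t < |f x|} ^ (1 / p) ≤ M / t := by
      rw [le_div_iff₀ ht, mul_comm]; exact h t ht
    calc μ.real {x | t < |f x|} = (μ.real {x | t < |f x|} ^ (1 / p)) ^ p := by
          rw [← Real.rpow_mul measureReal_nonneg, one_div_mul_cancel hp.ne', Real.rpow_one]
      _ ≤ _ := by gcongr
  rw [hlayer]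
  rcases hM.eq_or_lt with rfl | hM
  · rw [setLIntegral_congr_fun (g := fun _ => 0) measurableSet_Ioi]
    · simp
    · intro t ht
      have := htail t ht
      simp only [zero_div, Real.zero_rpow hp.ne', ENNReal.ofReal_zero, nonpos_iff_eq_zero] at this
      simp [this]
  set m := μ.real univ with hm
  have hm0 : 0 < m := by
    rw [hm, measureReal_def]
    exact ENNReal.toReal_pos (by simpa using hμ) (measure_ne_top _ _)
  set T := M * m ^ (-(1 / p)) with hT
  have hT0 : 0 < T := by positivity
  have hlow : ∫⁻ t in Ioc 0 T, μ {x | t < |f x|} * ENNReal.ofReal (t ^ (q - 1)) ≤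
      ENNReal.ofReal (m * (T ^ q / q)) := by
    calc _ ≤ ∫⁻ t in Ioc 0 T, ENNReal.ofReal m * ENNReal.ofReal (t ^ (q - 1)) := by
          refine lintegral_mono fun t => ?_
          rw [hm, ofReal_measureReal]
          gcongr
          exact subset_univ _
      _ = _ := by
          rw [lintegral_const_mul' _ _ ENNReal.ofReal_ne_top, ENNReal.ofReal_mul hm0.le,
            ← ofReal_integral_eq_lintegral_ofReal
              ((intervalIntegrable_iff_integrableOn_Ioc_of_le hT0.le).1
                (intervalIntegral.intervalIntegrable_rpow' (by linarith)))
              ((ae_restrict_mem measurableSet_Ioc).mono fun t ht =>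
                Real.rpow_nonneg ht.1.le _),
            ← intervalIntegral.integral_of_le hT0.le, integral_rpow (Or.inl (by linarith))]
          simp [Real.zero_rpow hq.ne']
  have hhigh : ∫⁻ t in Ioi T, μ {x | t < |f x|} * ENNReal.ofReal (t ^ (q - 1)) ≤
      ENNReal.ofReal (M ^ p * (T ^ (q - p) / (p - q))) := by
    calc _ ≤ ∫⁻ t in Ioi T, ENNReal.ofReal (M ^ p) * ENNReal.ofReal (t ^ (q - p - 1)) := by
          refine setLIntegral_mono' measurableSet_Ioi fun t ht => ?_
          have ht0 : 0 < t := hT0.trans ht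
          refine (mul_le_mul_left (htail t ht0) _).trans_eq ?_
          rw [← ENNReal.ofReal_mul (by positivity), ← ENNReal.ofReal_mul (by positivity),
            Real.div_rpow hM.le ht0.le, show q - p - 1 = (q - 1) - p by ring,
            Real.rpow_sub ht0 (q - 1) p]
          congr 1
          ring
      _ = _ := by
          rw [lintegral_const_mul' _ _ ENNReal.ofReal_ne_top, ENNReal.ofReal_mul (by positivity),
            ← ofReal_integral_eq_lintegral_ofReal
              (integrableOn_Ioi_rpow_of_lt (by linarith) hT0)
              ((ae_restrict_mem measurableSet_Ioi).mono fun t ht =>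
                Real.rpow_nonneg (hT0.trans ht).le _),
            integral_Ioi_rpow_of_lt (by linarith) hT0]
          congr 2
          rw [sub_add_cancel, ← neg_sub p q, div_neg, neg_div, neg_neg]
  rw [← Ioc_union_Ioi_eq_Ioi hT0.le,
    lintegral_union measurableSet_Ioi (Set.Ioc_disjoint_Ioi le_rfl)]
  refine (mul_le_mul_right (add_le_add hlow hhigh) _).trans_eq ?_
  have hpq : 0 < p - q := sub_pos.2 hqp
  rw [← ENNReal.ofReal_add (by positivity) (by positivity), ← ENNReal.ofReal_mul hq.le]
  congr 1
  have e1 : T ^ q = M ^ q * m ^ (-(q / p)) := by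
    rw [hT, Real.mul_rpow hM.le (by positivity), ← Real.rpow_mul hm0.le]
    congr 2; ring
  have e2 : T ^ (q - p) = M ^ (q - p) * m ^ (1 - q / p) := by
    rw [hT, Real.mul_rpow hM.le (by positivity), ← Real.rpow_mul hm0.le]
    congr 2; field_simp; ring
  have e3 : M ^ p * M ^ (q - p) = M ^ q := by
    rw [← Real.rpow_add hM]; congr 1; ring
  have e4 : m * m ^ (-(q / p)) = m ^ (1 - q / p) := by
    rw [sub_eq_add_neg, Real.rpow_add hm0, Real.rpow_one]
  rw [e1, e2]
  calc _ = (m * m ^ (-(q / p))) * M ^ q +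
        q / (p - q) * (M ^ p * M ^ (q - p)) * m ^ (1 - q / p) := by
        field_simp
    _ = _ := by
        rw [e3, e4]; field_simp; ring

/-- **Lemma 2.7, case `n ≥ 3`.** For `p > n/2` and `γ ∈ (0,2)` there is `C = C(n,p,γ) > 0`
such that for any measurable `E ⊆ B₁`, any measurable `f` with weak `L^{p,∞}(E)` quasinorm
bounded by `M`, and any `u ∈ C¹_c(ℝⁿ)`,
`∫_E |f| |u|^γ ≤ C M (‖u‖_{L²} + ‖∇u‖_{L²})^γ |E|^{(2-γ)/2 + γ/n - 1/p}`. -/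
theorem fu_gamma_estimate_dim_ge_three
    (n : ℕ) (hn : 3 ≤ n) (p γ : ℝ) (hp : (n : ℝ) / 2 < p) (hγ : γ ∈ Set.Ioo (0 : ℝ) 2) :
    ∃ C : ℝ, 0 < C ∧
      ∀ (E : Set (EuclideanSpace ℝ (Fin n))), MeasurableSet E → E ⊆ ball 0 1 →
      ∀ (f : EuclideanSpace ℝ (Fin n) → ℝ), Measurable f →
      ∀ M : ℝ, 0 ≤ M →
        (∀ t : ℝ, 0 < t →
          t * ((volume {x ∈ E | t < |f x|}).toReal) ^ (1 / p) ≤ M) →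
      ∀ (u : EuclideanSpace ℝ (Fin n) → ℝ), ContDiff ℝ 1 u → HasCompactSupport u →
        ∫ x in E, |f x| * |u x| ^ γ ≤
          C * M *
            ((eLpNorm u 2 volume).toReal + (eLpNorm (fderiv ℝ u) 2 volume).toReal) ^ γ *
            (volume E).toReal ^ ((2 - γ) / 2 + γ / (n : ℝ) - 1 / p) := by
  obtain ⟨hγ0, hγ2⟩ := hγ
  have hn3 : (3 : ℝ) ≤ n := by exact_mod_cast hn
  have hn0 : (0 : ℝ) < n := by linarith
  have hn2 : (0 : ℝ) < n - 2 := by linarith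
  have hp0 : 0 < p := by linarith
  set a : ℝ := (2 - γ) / 2 + γ / n with ha
  set b : ℝ := γ * (1 / 2 - 1 / n) with hb
  have hab : a + b = 1 := by rw [ha, hb]; ring
  have hb0 : 0 < b := by
    rw [hb, show (1 / 2 - 1 / n : ℝ) = (n - 2) / (2 * n) by field_simp]
    positivity
  have ha0 : 0 < a := by
    have : 0 < γ / n := by positivity
    rw [ha]; linarith
  have hpa : 1 / p < a := by
    have h1 : 1 / p < 2 / n := by
      rw [div_lt_div_iff₀ hp0 hn0]; linarith
    have h2 : a - 2 / n = (2 - γ) * (n - 2) / (2 * n) := by rw [ha]; field_simp; ring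
    have h3 : 0 < (2 - γ) * (n - 2) / (2 * n) := by
      have : 0 < 2 - γ := by linarith
      positivity
    linarith
  set q : ℝ := a⁻¹ with hq
  have hq0 : 0 < q := inv_pos.2 ha0
  have hqp : q < p := by
    rw [hq, inv_lt_comm₀ ha0 hp0, ← one_div]; exact hpa
  have hconj : q.HolderConjugate b⁻¹ := by
    rw [Real.holderConjugate_iff, hq, inv_inv, inv_inv]
    exact ⟨(one_lt_inv₀ ha0).2 (by linarith), hab⟩
  let r : NNReal := ⟨γ * b⁻¹, by positivity⟩
  have hr : (r : ℝ) = γ * b⁻¹ := rfl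
  have hr0 : (r : ℝ) ≠ 0 := by rw [hr]; positivity
  let S : NNReal := eLpNormLESNormFDerivOfEqInnerConst
    (volume : Measure (EuclideanSpace ℝ (Fin n))) 2
  refine ⟨(p / (p - q)) ^ a * ((S : ℝ) + 1) ^ γ, ?_, ?_⟩
  · have : 0 < p - q := sub_pos.2 hqp
    positivity
  intro E hE hEball f hf M hM hweak u hu hsupp
  have hpq : 0 < p - q := sub_pos.2 hqp
  have hEfin : volume E ≠ ⊤ := ((measure_mono hEball).trans_lt measure_ball_lt_top).ne
  have : IsFiniteMeasure (volume.restrict E) := ⟨by simpa using hEfin.lt_top⟩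
  have hSob : eLpNorm u r volume ≤ S * eLpNorm (fderiv ℝ u) 2 volume := by
    refine eLpNorm_le_eLpNorm_fderiv_of_eq_inner volume hu hsupp (p := 2) (by norm_num)
      (by simpa using by omega) ?_
    rw [hr, hb]
    simp
    field_simp
  have hDfin : eLpNorm (fderiv ℝ u) 2 volume ≠ ⊤ :=
    ((hu.continuous_fderiv one_ne_zero).memLp_of_hasCompactSupport (hsupp.fderiv ℝ)).eLpNorm_ne_top
  set D := (eLpNorm (fderiv ℝ u) 2 volume).toReal with hD
  have hfq : (∫⁻ x in E, ‖f x‖ₑ ^ q) ^ (1 / q) ≤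
      ENNReal.ofReal ((p / (p - q)) ^ a * M * (volume E).toReal ^ (a - 1 / p)) := by
    have := lintegral_enorm_rpow_le_of_weak_bound (μ := volume.restrict E) hf hq0 hqp hM
      (fun t ht => by
        rw [measureReal_def, Measure.restrict_apply (measurableSet_lt measurable_const hf.abs),
          inter_comm]
        exact hweak t ht)
    refine (ENNReal.rpow_le_rpow this (by positivity)).trans_eq ?_
    rw [ENNReal.ofReal_rpow_of_nonneg (by positivity) (by positivity),
      measureReal_restrict_apply_univ,
      measureReal_def, Real.mul_rpow (by positivity) (by positivity),
      Real.mul_rpow (by positivity) (by positivity), ← Real.rpow_mul hM,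
      ← Real.rpow_mul ENNReal.toReal_nonneg, mul_one_div_cancel hq0.ne', Real.rpow_one,
      show (1 - q / p) * (1 / q) = a - 1 / p by rw [hq]; field_simp, one_div, hq, inv_inv]
  have huq : (∫⁻ x in E, (‖u x‖ₑ ^ γ) ^ b⁻¹) ^ (1 / b⁻¹) ≤ ENNReal.ofReal ((S * D) ^ γ) := by
    calc _ ≤ (∫⁻ x, ‖u x‖ₑ ^ (r : ℝ)) ^ (1 / b⁻¹) := by
          simp_rw [← ENNReal.rpow_mul, ← hr]
          gcongr
          exact Measure.restrict_le_self
      _ = eLpNorm u r volume ^ γ := by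
          rw [eLpNorm_nnreal_eq_lintegral (by exact_mod_cast hr0), ← ENNReal.rpow_mul, hr]
          congr 1
          field_simp
      _ ≤ (S * eLpNorm (fderiv ℝ u) 2 volume) ^ γ := by gcongr
      _ = _ := by
          rw [← ENNReal.ofReal_rpow_of_nonneg (by positivity) hγ0.le,
            ENNReal.ofReal_mul (by positivity), hD, ENNReal.ofReal_toReal hDfin,
            ENNReal.ofReal_coe_nnreal]
  have hint : ∫⁻ x in E, ENNReal.ofReal (|f x| * |u x| ^ γ) ≤
      ENNReal.ofReal ((p / (p - q)) ^ a * M * (volume E).toReal ^ (a - 1 / p) * (S * D) ^ γ) := by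
    calc _ = ∫⁻ x in E, ((fun x => ‖f x‖ₑ) * fun x => ‖u x‖ₑ ^ γ) x := by
          refine lintegral_congr fun x => ?_
          rw [ENNReal.ofReal_mul (abs_nonneg _), Pi.mul_apply,
            ← ENNReal.ofReal_rpow_of_nonneg (abs_nonneg _) hγ0.le,
            Real.enorm_eq_ofReal_abs, Real.enorm_eq_ofReal_abs]
      _ ≤ _ := ENNReal.lintegral_mul_le_Lp_mul_Lq _ hconj hf.enorm.aemeasurable
          (hu.continuous.measurable.enorm.pow_const γ).aemeasurable
      _ ≤ _ := mul_le_mul' hfq huq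
      _ = _ := (ENNReal.ofReal_mul (by positivity)).symm
  rw [integral_eq_lintegral_of_nonneg_ae (Filter.Eventually.of_forall fun x => by positivity)
    (by have := hu.continuous.measurable; fun_prop)]
  refine (ENNReal.toReal_le_of_le_ofReal (by positivity) hint).trans ?_
  have hmono : ((S : ℝ) * D) ^ γ ≤
      ((S : ℝ) + 1) ^ γ * ((eLpNorm u 2 volume).toReal + D) ^ γ := by
    rw [← Real.mul_rpow (by positivity) (by positivity)]
    gcongr
    · linarith
    · linarith [ENNReal.toReal_nonneg (a := eLpNorm u 2 volume)]
  calc _ ≤ (p / (p - q)) ^ a * M * (volume E).toReal ^ (a - 1 / p) *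
        (((S : ℝ) + 1) ^ γ * ((eLpNorm u 2 volume).toReal + D) ^ γ) := by gcongr
    _ = _ := by ring
end

section
/- Let n = 2, p > 1, γ ∈ (0,2), and let ε satisfy 0 < ε < min(γ/2, 1 - 1/p). There exists a constant C = C(p,γ,ε) > 0 such that: for every Lebesgue-measurable set E contained in the open unit ball B₁ ⊂ ℝ², every measurable f : ℝ² → ℝ with ‖f‖_{L^{p,∞}(E)} < ∞, and every continuously differentiable u : ℝ² → ℝ with compact support, one has ∫_E |f| · |u|^γ dx ≤ C · ‖f‖_{L^{p,∞}(E)} · ( ‖u‖_{L²(ℝ²)} + ‖∇u‖_{L²(ℝ²)} )^γ · |E|^{1 - 1/p - ε}. -/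
open MeasureTheory Metric Set

open scoped NNReal ENNReal

/-- A function of finite weak `L^p` quasinorm on a finite measure space is in `L^r` for `r < p`. -/
theorem lintegral_rpow_le_of_weak_bound {α : Type*} [MeasurableSpace α] {μ : Measure α}
    [IsFiniteMeasure μ] {f : α → ℝ} (hf : AEMeasurable f μ) {p r M : ℝ} (hr : 0 < r) (hrp : r < p)
    (hM : 0 ≤ M) (h : ∀ t : ℝ, 0 < t → t * μ.real {x | t < |f x|} ^ (1 / p) ≤ M) :
    ∫⁻ x, ENNReal.ofReal (|f x| ^ r) ∂μ ≤
      ENNReal.ofReal (p / (p - r) * (M ^ r * μ.real univ ^ (1 - r / p))) := by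
  have hp : 0 < p := hr.trans hrp
  rw [lintegral_rpow_eq_lintegral_meas_lt_mul μ (.of_forall fun x => abs_nonneg (f x))
    hf.abs hr]
  have hdecay : ∀ t : ℝ, 0 < t → μ.real {x | t < |f x|} ≤ M ^ p * t ^ (-p) := by
    intro t ht
    have h1 : μ.real {x | t < |f x|} ^ (1 / p) ≤ M / t := by
      rw [le_div_iff₀ ht, mul_comm]
      exact h t ht
    have h2 := Real.rpow_le_rpow (by positivity) h1 hp.le
    rwa [← Real.rpow_mul measureReal_nonneg, one_div_mul_cancel hp.ne', Real.rpow_one,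
      Real.div_rpow hM ht.le, div_eq_mul_inv, ← Real.rpow_neg ht.le] at h2
  rcases eq_or_ne (μ univ) 0 with hμ | hμ
  · have : μ = 0 := Measure.measure_univ_eq_zero.mp hμ
    simp [this]
  rcases hM.eq_or_lt with rfl | hM
  · have : ∫⁻ t in Ioi (0 : ℝ), μ {a | t < |f a|} * ENNReal.ofReal (t ^ (r - 1)) = 0 := by
      refine setLIntegral_eq_zero measurableSet_Ioi fun t ht => ?_
      have h1 := hdecay t ht
      rw [Real.zero_rpow hp.ne', zero_mul] at h1
      have h2 : μ {x | t < |f x|} = 0 :=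
        (measureReal_eq_zero_iff).mp (le_antisymm h1 measureReal_nonneg)
      simp [h2]
    rw [this]
    simp
  set A := μ.real univ with hA
  have hA0 : 0 < A := by
    rw [hA, measureReal_def]
    exact ENNReal.toReal_pos hμ (measure_ne_top _ _)
  set T := M * A ^ (-(1 / p)) with hT
  have hT0 : 0 < T := by positivity
  have hlow : ∫⁻ t in Ioc 0 T, μ {a | t < |f a|} * ENNReal.ofReal (t ^ (r - 1)) ≤
      ENNReal.ofReal (A * (T ^ r / r)) := by
    have hint : IntegrableOn (fun t : ℝ => t ^ (r - 1)) (Ioc 0 T) :=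
      (intervalIntegrable_iff_integrableOn_Ioc_of_le hT0.le).mp
        (intervalIntegral.intervalIntegrable_rpow' (by linarith))
    have hval : ∫ t in Ioc 0 T, t ^ (r - 1) = T ^ r / r := by
      rw [← intervalIntegral.integral_of_le hT0.le, integral_rpow (Or.inl (by linarith))]
      simp [Real.zero_rpow hr.ne']
    rw [ENNReal.ofReal_mul hA0.le, ← hval, ofReal_integral_eq_lintegral_ofReal hint,
      ← lintegral_const_mul']
    · refine lintegral_mono fun t => ?_
      gcongr
      rw [hA, ofReal_measureReal]
      exact measure_mono (subset_univ _)
    · exact ENNReal.ofReal_ne_top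
    · filter_upwards [ae_restrict_mem measurableSet_Ioc] with t ht
      exact Real.rpow_nonneg ht.1.le _
  have hhigh : ∫⁻ t in Ioi T, μ {a | t < |f a|} * ENNReal.ofReal (t ^ (r - 1)) ≤
      ENNReal.ofReal (M ^ p * (T ^ (r - p) / (p - r))) := by
    have hlt : r - p - 1 < -1 := by linarith
    have hint : IntegrableOn (fun t : ℝ => t ^ (r - p - 1)) (Ioi T) :=
      integrableOn_Ioi_rpow_of_lt hlt hT0
    have hval : ∫ t in Ioi T, t ^ (r - p - 1) = T ^ (r - p) / (p - r) := by
      rw [integral_Ioi_rpow_of_lt hlt hT0, sub_add_cancel, ← neg_sub p r, div_neg, neg_div, neg_neg]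
    rw [ENNReal.ofReal_mul (by positivity), ← hval, ofReal_integral_eq_lintegral_ofReal hint,
      ← lintegral_const_mul']
    · refine setLIntegral_mono' measurableSet_Ioi fun t ht => ?_
      have ht0 : 0 < t := hT0.trans ht
      rw [← ofReal_measureReal, ← ENNReal.ofReal_mul measureReal_nonneg,
        ← ENNReal.ofReal_mul (by positivity)]
      apply ENNReal.ofReal_le_ofReal
      calc μ.real {a | t < |f a|} * t ^ (r - 1) ≤ M ^ p * t ^ (-p) * t ^ (r - 1) := by
            gcongr
            exact hdecay t ht0
        _ = M ^ p * t ^ (r - p - 1) := by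
            rw [mul_assoc, ← Real.rpow_add ht0]
            ring_nf
    · exact ENNReal.ofReal_ne_top
    · filter_upwards [ae_restrict_mem measurableSet_Ioi] with t ht
      exact Real.rpow_nonneg (hT0.trans ht).le _
  have hpr : 0 < p - r := sub_pos.mpr hrp
  rw [← Ioc_union_Ioi_eq_Ioi hT0.le, lintegral_union measurableSet_Ioi
    (Ioc_disjoint_Ioi le_rfl)]
  refine (mul_le_mul_right (add_le_add hlow hhigh) _).trans ?_
  rw [← ENNReal.ofReal_add (by positivity) (by positivity), ← ENNReal.ofReal_mul hr.le]
  apply ENNReal.ofReal_le_ofReal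
  have h1 : A * T ^ r = M ^ r * A ^ (1 - r / p) := by
    rw [hT, Real.mul_rpow hM.le (by positivity), ← Real.rpow_mul hA0.le, mul_left_comm]
    congr 1
    nth_rw 1 [← Real.rpow_one A]
    rw [← Real.rpow_add hA0]
    ring_nf
  have h2 : M ^ p * T ^ (r - p) = M ^ r * A ^ (1 - r / p) := by
    rw [hT, Real.mul_rpow hM.le (by positivity), ← Real.rpow_mul hA0.le, ← mul_assoc,
      ← Real.rpow_add hM]
    congr 2
    · ring
    · field_simp
      ring
  rw [← mul_div_assoc, ← mul_div_assoc, h1, h2]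
  apply le_of_eq
  field_simp
  ring

/-- The planar Sobolev embedding `H¹ ⊂ L^q` on the unit ball, for every finite `q > 2`. -/
theorem exists_eLpNorm_ball_le_eLpNorm_add_eLpNorm_fderiv {q : ℝ≥0} (hq : 2 < q) :
    ∃ K : ℝ≥0, ∀ u : EuclideanSpace ℝ (Fin 2) → ℝ, ContDiff ℝ 1 u →
      eLpNorm u q (volume.restrict (ball 0 1)) ≤
        K * (eLpNorm u 2 volume + eLpNorm (fderiv ℝ u) 2 volume) := by
  let φ : ContDiffBump (0 : EuclideanSpace ℝ (Fin 2)) := ⟨1, 2, one_pos, one_lt_two⟩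
  have hφ : ContDiff ℝ 1 φ := φ.contDiff
  obtain ⟨D, hD⟩ := (φ.hasCompactSupport.fderiv ℝ).exists_bound_of_continuous
    (hφ.continuous_fderiv one_ne_zero)
  have hD0 : 0 ≤ D := (norm_nonneg _).trans (hD 0)
  have hq0 : 0 < q := two_pos.trans hq
  let s : ℝ≥0 := (q⁻¹ + 2⁻¹)⁻¹
  have hs1 : 1 ≤ s := by
    rw [one_le_inv₀ (by positivity)]
    calc q⁻¹ + 2⁻¹ ≤ 2⁻¹ + 2⁻¹ := by gcongr
      _ = 1 := by
        rw [← two_mul, mul_inv_cancel₀ two_ne_zero]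
  have hs2 : s < 2 := by
    rw [inv_lt_comm₀ (by positivity) two_pos]
    exact lt_add_of_pos_left _ (by positivity)
  let S : Set (EuclideanSpace ℝ (Fin 2)) := closedBall 0 2
  have hS : volume S ≠ ∞ := measure_closedBall_lt_top.ne
  let V : ℝ≥0∞ := volume S ^ (1 / (s : ℝ≥0∞).toReal - 1 / (2 : ℝ≥0∞).toReal)
  have hV : V ≠ ∞ := by
    refine ENNReal.rpow_ne_top_of_nonneg ?_ hS
    simp only [ENNReal.coe_toReal, ENNReal.toReal_ofNat, sub_nonneg]
    gcongr
    exact_mod_cast hs2.le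
  let G := eLpNormLESNormFDerivOfLeConst ℝ (volume : Measure (EuclideanSpace ℝ (Fin 2))) S s q
  refine ⟨G * V.toNNReal * max 1 D.toNNReal, fun u hu => ?_⟩
  let v : EuclideanSpace ℝ (Fin 2) → ℝ := fun x => φ x * u x
  have hv : ContDiff ℝ 1 v := hφ.mul hu
  have hvsupp : tsupport v ⊆ S := by
    refine (tsupport_mul_subset_left (f := φ) (g := u)).trans ?_
    rw [φ.tsupport_eq]
  have huv : eLpNorm u q (volume.restrict (ball 0 1)) ≤ eLpNorm v q volume := by
    calc eLpNorm u q (volume.restrict (ball 0 1)) = eLpNorm v q (volume.restrict (ball 0 1)) := by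
          refine eLpNorm_congr_ae ?_
          filter_upwards [ae_restrict_mem measurableSet_ball] with x hx
          simp [v, φ.one_of_mem_closedBall (ball_subset_closedBall hx)]
      _ ≤ eLpNorm v q volume := eLpNorm_mono_measure _ Measure.restrict_le_self
  have hsob : eLpNorm v q volume ≤ G * eLpNorm (fderiv ℝ v) s volume := by
    refine eLpNorm_le_eLpNorm_fderiv_of_le volume hv ((subset_tsupport v).trans hvsupp) hs1
      ?_ ?_ isBounded_closedBall
    · simpa using hs2
    · simp [s]
  have hholder : eLpNorm (fderiv ℝ v) s volume ≤ eLpNorm (fderiv ℝ v) 2 volume * V := by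
    have hgsupp : Function.support (fun x => ‖fderiv ℝ v x‖) ⊆ S := fun x hx =>
      hvsupp (support_fderiv_subset ℝ (norm_ne_zero_iff.mp hx))
    rw [← eLpNorm_norm, ← eLpNorm_norm (p := 2), ← eLpNorm_restrict_eq_of_support_subset hgsupp,
      ← eLpNorm_restrict_eq_of_support_subset (p := 2) hgsupp]
    have hs2' : (s : ℝ≥0∞) ≤ 2 := by exact_mod_cast hs2.le
    simpa [V] using eLpNorm_le_eLpNorm_mul_rpow_measure_univ (μ := volume.restrict S) hs2'
      (hv.continuous_fderiv one_ne_zero).norm.aestronglyMeasurable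
  have hleib : eLpNorm (fderiv ℝ v) 2 volume ≤
      (max 1 D.toNNReal : ℝ≥0) * (eLpNorm u 2 volume + eLpNorm (fderiv ℝ u) 2 volume) := by
    have hpt : ∀ x, ‖fderiv ℝ v x‖ ≤
        (max 1 D.toNNReal : ℝ≥0) * ‖(‖u x‖ + ‖fderiv ℝ u x‖)‖ := by
      intro x
      have hfd : fderiv ℝ v x = φ x • fderiv ℝ u x + u x • fderiv ℝ φ x :=
        fderiv_fun_mul (hφ.differentiable one_ne_zero x) (hu.differentiable one_ne_zero x)
      rw [hfd, Real.norm_of_nonneg (by positivity : 0 ≤ ‖u x‖ + ‖fderiv ℝ u x‖)]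
      refine (norm_add_le _ _).trans ?_
      rw [norm_smul, norm_smul, Real.norm_of_nonneg φ.nonneg]
      have h1 : φ x ≤ (max 1 D.toNNReal : ℝ≥0) :=
        φ.le_one.trans (by exact_mod_cast le_max_left _ _)
      have h2 : ‖fderiv ℝ φ x‖ ≤ (max 1 D.toNNReal : ℝ≥0) :=
        (hD x).trans (by rw [NNReal.coe_max, Real.coe_toNNReal D hD0]; exact le_max_right _ _)
      nlinarith [mul_le_mul_of_nonneg_right h1 (norm_nonneg (fderiv ℝ u x)),
        mul_le_mul_of_nonneg_left h2 (norm_nonneg (u x))]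
    calc eLpNorm (fderiv ℝ v) 2 volume
        ≤ (max 1 D.toNNReal : ℝ≥0) • eLpNorm (fun x => ‖u x‖ + ‖fderiv ℝ u x‖) 2 volume :=
          eLpNorm_le_nnreal_smul_eLpNorm_of_ae_le_mul (.of_forall hpt) 2
      _ ≤ (max 1 D.toNNReal : ℝ≥0) • (eLpNorm (fun x => ‖u x‖) 2 volume +
            eLpNorm (fun x => ‖fderiv ℝ u x‖) 2 volume) := by
          gcongr
          exact eLpNorm_add_le hu.continuous.norm.aestronglyMeasurable
            (hu.continuous_fderiv one_ne_zero).norm.aestronglyMeasurable one_le_two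
      _ = _ := by rw [eLpNorm_norm, eLpNorm_norm, ENNReal.smul_def, smul_eq_mul]
  calc eLpNorm u q (volume.restrict (ball 0 1))
      ≤ G * (((max 1 D.toNNReal : ℝ≥0) *
          (eLpNorm u 2 volume + eLpNorm (fderiv ℝ u) 2 volume)) * V) :=
        huv.trans (hsob.trans (by gcongr; exact hholder.trans (by gcongr)))
    _ = _ := by
        rw [ENNReal.coe_mul, ENNReal.coe_mul, ENNReal.coe_toNNReal hV]
        ring

/-- **Lemma 2.7, case `n = 2`.** For `p > 1`, `γ ∈ (0,2)` and `0 < ε < min(γ/2, 1 - 1/p)`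
there is `C = C(p,γ,ε) > 0` such that for any measurable `E ⊆ B₁ ⊂ ℝ²`, any measurable `f`
with weak `L^{p,∞}(E)` quasinorm bounded by `M`, and any `u ∈ C¹_c(ℝ²)`,
`∫_E |f| |u|^γ ≤ C M (‖u‖_{L²} + ‖∇u‖_{L²})^γ |E|^{1 - 1/p - ε}`. -/
theorem fu_gamma_estimate_dim_two
    (p γ ε : ℝ) (hp : 1 < p) (hγ : γ ∈ Set.Ioo (0 : ℝ) 2)
    (hε : 0 < ε) (hε' : ε < min (γ / 2) (1 - 1 / p)) :
    ∃ C : ℝ, 0 < C ∧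
      ∀ (E : Set (EuclideanSpace ℝ (Fin 2))), MeasurableSet E → E ⊆ ball 0 1 →
      ∀ (f : EuclideanSpace ℝ (Fin 2) → ℝ), Measurable f →
      ∀ M : ℝ, 0 ≤ M →
        (∀ t : ℝ, 0 < t →
          t * ((volume {x ∈ E | t < |f x|}).toReal) ^ (1 / p) ≤ M) →
      ∀ (u : EuclideanSpace ℝ (Fin 2) → ℝ), ContDiff ℝ 1 u → HasCompactSupport u →
        ∫ x in E, |f x| * |u x| ^ γ ≤
          C * M *
            ((eLpNorm u 2 volume).toReal + (eLpNorm (fderiv ℝ u) 2 volume).toReal) ^ γ *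
            (volume E).toReal ^ (1 - 1 / p - ε) := by
  obtain ⟨hγ0, -⟩ := hγ
  obtain ⟨hεγ, hεp⟩ := lt_min_iff.mp hε'
  have hp0 : 0 < p := one_pos.trans hp
  have hε1 : ε < 1 := hεp.trans (by simpa using hp0)
  have hq : 2 < (γ / ε).toNNReal := by
    rw [Real.lt_toNNReal_iff_coe_lt, NNReal.coe_ofNat, lt_div_iff₀ hε]
    linarith
  obtain ⟨K, hK⟩ := exists_eLpNorm_ball_le_eLpNorm_add_eLpNorm_fderiv hq
  set r := (1 - ε)⁻¹ with hr
  have hr0 : 0 < r := inv_pos.mpr (by linarith)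
  have hrinv : 1 / r = 1 - ε := by rw [hr, one_div, inv_inv]
  have hrp : r < p := by
    rw [hr, inv_lt_comm₀ (by linarith) hp0, ← one_div]
    linarith
  have hconj : r.HolderConjugate ε⁻¹ := by
    rw [Real.holderConjugate_iff]
    refine ⟨?_, ?_⟩
    · rw [hr, one_lt_inv₀ (by linarith)]
      linarith
    · rw [hr, inv_inv, inv_inv]
      ring
  have hpr : 0 < p - r := sub_pos.mpr hrp
  refine ⟨(p / (p - r)) ^ (1 / r) * ((K : ℝ) + 1) ^ γ, by positivity, ?_⟩
  intro E hE hEB f hf M hM hweak u hu hsupp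
  have hEfin : volume E ≠ ∞ := ((measure_mono hEB).trans_lt measure_ball_lt_top).ne
  have : IsFiniteMeasure (volume.restrict E) := ⟨by simpa using hEfin.lt_top⟩
  have hfr : ∫⁻ x in E, ENNReal.ofReal |f x| ^ r ≤
      ENNReal.ofReal (p / (p - r) * (M ^ r * (volume E).toReal ^ (1 - r / p))) := by
    have hw := lintegral_rpow_le_of_weak_bound (μ := volume.restrict E) hf.aemeasurable hr0 hrp hM
      fun t ht => by
        have hm : MeasurableSet {x | t < |f x|} := measurableSet_lt measurable_const hf.abs
        rw [measureReal_def, Measure.restrict_apply hm, inter_comm]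
        exact hweak t ht
    simpa [measureReal_def, ENNReal.ofReal_rpow_of_nonneg (abs_nonneg _) hr0.le] using hw
  set N := (eLpNorm u 2 volume).toReal + (eLpNorm (fderiv ℝ u) 2 volume).toReal with hN
  have hN0 : 0 ≤ N := by positivity
  have hu2 : eLpNorm u 2 volume ≠ ∞ := (hu.continuous.memLp_of_hasCompactSupport hsupp).2.ne
  have hdu2 : eLpNorm (fderiv ℝ u) 2 volume ≠ ∞ :=
    ((hu.continuous_fderiv one_ne_zero).memLp_of_hasCompactSupport (hsupp.fderiv ℝ)).2.ne
  have hug : (∫⁻ x in E, ENNReal.ofReal (|u x| ^ γ) ^ ε⁻¹) ^ (1 / ε⁻¹) ≤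
      ENNReal.ofReal ((K * N) ^ γ) := by
    have hnorm : eLpNorm u (γ / ε).toNNReal (volume.restrict E) ≤ ENNReal.ofReal (K * N) := by
      refine (eLpNorm_mono_measure _ (Measure.restrict_mono_set volume hEB)).trans
        ((hK u hu).trans ?_)
      rw [ENNReal.ofReal_mul (p := (K : ℝ)) K.2, ENNReal.ofReal_coe_nnreal, hN,
        ENNReal.ofReal_add ENNReal.toReal_nonneg ENNReal.toReal_nonneg,
        ENNReal.ofReal_toReal hu2, ENNReal.ofReal_toReal hdu2]
    rw [eLpNorm_nnreal_eq_lintegral (by positivity), Real.coe_toNNReal _ (by positivity)] at hnorm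
    have hpow := ENNReal.rpow_le_rpow hnorm hγ0.le
    rw [← ENNReal.rpow_mul, ENNReal.ofReal_rpow_of_nonneg (by positivity) hγ0.le] at hpow
    convert hpow using 2
    · refine lintegral_congr fun x => ?_
      rw [← ENNReal.ofReal_rpow_of_nonneg (abs_nonneg _) hγ0.le, ← ENNReal.rpow_mul,
        ← div_eq_mul_inv, Real.enorm_eq_ofReal_abs]
    · field_simp
  have hholder : ∫⁻ x in E, ENNReal.ofReal (|f x| * |u x| ^ γ) ≤
      ENNReal.ofReal ((p / (p - r) * (M ^ r * (volume E).toReal ^ (1 - r / p))) ^ (1 / r) *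
        (K * N) ^ γ) := by
    rw [ENNReal.ofReal_mul (by positivity),
      ← ENNReal.ofReal_rpow_of_nonneg (p := 1 / r) (by positivity) (by positivity)]
    calc ∫⁻ x in E, ENNReal.ofReal (|f x| * |u x| ^ γ)
        = ∫⁻ x in E, ((fun x => ENNReal.ofReal |f x|) *
            fun x => ENNReal.ofReal (|u x| ^ γ)) x := by
          simp only [Pi.mul_apply, ENNReal.ofReal_mul (abs_nonneg _)]
      _ ≤ (∫⁻ x in E, ENNReal.ofReal |f x| ^ r) ^ (1 / r) *
            (∫⁻ x in E, ENNReal.ofReal (|u x| ^ γ) ^ ε⁻¹) ^ (1 / ε⁻¹) :=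
          ENNReal.lintegral_mul_le_Lp_mul_Lq _ hconj hf.abs.ennreal_ofReal.aemeasurable
            (hu.continuous.measurable.abs.pow_const γ).ennreal_ofReal.aemeasurable
      _ ≤ _ := by gcongr
  rw [integral_eq_lintegral_of_nonneg_ae (.of_forall fun x => by positivity)
    (Measurable.aestronglyMeasurable
      (by exact hf.abs.mul (hu.continuous.measurable.abs.pow_const γ)))]
  refine (ENNReal.toReal_le_of_le_ofReal (by positivity) hholder).trans ?_
  have hV0 : 0 ≤ (volume E).toReal := ENNReal.toReal_nonneg
  have hexp : (1 - r / p) * (1 / r) = 1 - 1 / p - ε := by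
    have : (1 - r / p) * (1 / r) = 1 / r - 1 / p := by field_simp
    rw [this, hrinv]
    ring
  rw [Real.mul_rpow (by positivity) (by positivity), Real.mul_rpow (by positivity) (by positivity),
    ← Real.rpow_mul hM, mul_one_div_cancel hr0.ne', Real.rpow_one, ← Real.rpow_mul hV0, hexp,
    Real.mul_rpow (x := (K : ℝ)) K.2 hN0]
  have hKle : (K : ℝ) ^ γ ≤ ((K : ℝ) + 1) ^ γ :=
    Real.rpow_le_rpow K.2 (by linarith) hγ0.le
  calc (p / (p - r)) ^ (1 / r) * (M * (volume E).toReal ^ (1 - 1 / p - ε)) * ((K : ℝ) ^ γ * N ^ γ)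
      ≤ (p / (p - r)) ^ (1 / r) * (M * (volume E).toReal ^ (1 - 1 / p - ε)) *
          (((K : ℝ) + 1) ^ γ * N ^ γ) := by gcongr
    _ = _ := by ring
end
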